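/- arXiv:1805.04480 — 4 statements merged into one kernel-verified Lean document; each statement's English description precedes it below -/
import Mathlib

section
/- There exists a 3-system P = (P₁,P₂,P₃) such that liminf_{q→∞} P₁(q)/q = −2, liminf_{q→∞} P₂(q)/q = −1/2, liminf_{q→∞} P₃(q)/q = 1, limsup_{q→∞} P₁(q)/q = −1/2, limsup_{q→∞} P₂(q)/q = 1, and limsup_{q→∞} P₃(q)/q = 1. -/
open Filter

/-- An `n`-system in the sense of Schmidt and Summerer: an `n`-tuple of continuous
piecewise linear functions on `[0,∞)`, vanishing at `0`, with all slopes among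
`{-(n-1), 1}`, ordered `P 0 ≤ P 1 ≤ ⋯`, summing to `0`, and satisfying the switch
condition: if at a switch point some `P i` changes from slope `-(n-1)` to slope `1`
and some `P j` changes from slope `1` to slope `-(n-1)`, then `i < j` unless the two
functions agree there. The piecewise linear structure is given by an unbounded
increasing sequence of breakpoints `t` with slopes `σ k j` on `[t k, t (k+1)]`. -/
def IsNSystem (n : ℕ) (P : Fin n → ℝ → ℝ) : Prop :=
  ∃ t : ℕ → ℝ, ∃ σ : ℕ → Fin n → ℝ,
    t 0 = 0 ∧ StrictMono t ∧ Filter.Tendsto t Filter.atTop Filter.atTop ∧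
    (∀ j, P j 0 = 0) ∧
    (∀ k j, σ k j = -((n : ℝ) - 1) ∨ σ k j = 1) ∧
    (∀ k, ∀ j, ∀ q ∈ Set.Icc (t k) (t (k + 1)), P j q = P j (t k) + σ k j * (q - t k)) ∧
    (∀ q, 0 ≤ q → ∀ i j : Fin n, i ≤ j → P i q ≤ P j q) ∧
    (∀ q, 0 ≤ q → ∑ j, P j q = 0) ∧
    (∀ k, ∀ i j : Fin n,
      σ k i = -((n : ℝ) - 1) → σ (k + 1) i = 1 → σ k j = 1 → σ (k + 1) j = -((n : ℝ) - 1) →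
      i < j ∨ P i (t (k + 1)) = P j (t (k + 1)))

theorem limsup_eq_of_eventually_le_of_frequently_ge {f : ℝ → ℝ} {a : ℝ}
    (hle : ∀ᶠ x in atTop, f x ≤ a) (hfreq : ∀ b < a, ∃ᶠ x in atTop, b ≤ f x) :
    limsup f atTop = a := by
  have hcob : IsCoboundedUnder (· ≤ ·) atTop f :=
    IsCoboundedUnder.of_frequently_ge (hfreq (a - 1) (by linarith))
  refine le_antisymm (limsup_le_of_le hcob hle) (le_of_forall_lt fun b hb => ?_)
  obtain ⟨c, hbc, hca⟩ := exists_between hb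
  exact hbc.trans_le (le_limsup_of_frequently_le (hfreq c hca) ⟨a, hle⟩)

theorem liminf_eq_of_eventually_ge_of_frequently_le {f : ℝ → ℝ} {a : ℝ}
    (hge : ∀ᶠ x in atTop, a ≤ f x) (hfreq : ∀ b > a, ∃ᶠ x in atTop, f x ≤ b) :
    liminf f atTop = a := by
  have hcob : IsCoboundedUnder (· ≥ ·) atTop f :=
    IsCoboundedUnder.of_frequently_le (hfreq (a + 1) (by linarith))
  refine le_antisymm (le_of_forall_gt fun b hb => ?_) (le_liminf_of_le hcob hge)
  obtain ⟨c, hac, hcb⟩ := exists_between hb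
  exact (liminf_le_of_frequently_le (hfreq c hac) ⟨a, hge⟩).trans_lt hcb

namespace ZigzagSystem

/-- The meeting points of the two lower components. -/
noncomputable def node (k : ℕ) : ℝ := ((k + 1).factorial : ℝ) - 1

theorem node_zero : node 0 = 0 := by simp [node]

theorem node_succ (k : ℕ) : node (k + 1) = (k + 2) * (node k + 1) - 1 := by
  simp only [node, Nat.factorial_succ (k + 1)]
  push_cast
  ring

theorem le_node (k : ℕ) : (k : ℝ) ≤ node k := by
  have h : ((k + 1 : ℕ) : ℝ) ≤ ((k + 1).factorial : ℝ) := by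
    exact_mod_cast Nat.self_le_factorial (k + 1)
  push_cast at h
  unfold node
  linarith

theorem node_nonneg (k : ℕ) : 0 ≤ node k := (Nat.cast_nonneg k).trans (le_node k)

theorem node_lt_succ (k : ℕ) : node k < node (k + 1) := by
  rw [node_succ]
  nlinarith [node_nonneg k, Nat.cast_nonneg (α := ℝ) k]

theorem node_strictMono : StrictMono node := strictMono_nat_of_lt_succ node_lt_succ

/-- The distance to the nearest node. -/
noncomputable def tent (q : ℝ) : ℝ := Metric.infDist q (Set.range node)

theorem tent_nonneg (q : ℝ) : 0 ≤ tent q := Metric.infDist_nonneg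

theorem tent_le_abs (q : ℝ) (k : ℕ) : tent q ≤ |q - node k| :=
  Metric.infDist_le_dist_of_mem (Set.mem_range_self k)

theorem tent_le_self {q : ℝ} (hq : 0 ≤ q) : tent q ≤ q := by
  simpa [node_zero, abs_of_nonneg hq] using tent_le_abs q 0

theorem tent_node (k : ℕ) : tent (node k) = 0 :=
  Metric.infDist_zero_of_mem (Set.mem_range_self k)

theorem tent_eq_min {q : ℝ} {k : ℕ} (h₁ : node k ≤ q) (h₂ : q ≤ node (k + 1)) :
    tent q = min (q - node k) (node (k + 1) - q) := by
  apply le_antisymm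
  · refine le_min ?_ ?_
    · simpa [abs_of_nonneg (sub_nonneg.2 h₁)] using tent_le_abs q k
    · simpa [abs_of_nonpos (sub_nonpos.2 h₂)] using tent_le_abs q (k + 1)
  · refine (Metric.le_infDist (Set.range_nonempty node)).2 ?_
    rintro _ ⟨m, rfl⟩
    rw [Real.dist_eq]
    rcases Nat.lt_or_ge k m with h | h
    · have := node_strictMono.monotone (Nat.succ_le_of_lt h)
      exact (min_le_right _ _).trans (by linarith [neg_abs_le (q - node m)])
    · have := node_strictMono.monotone h
      exact (min_le_left _ _).trans (by linarith [le_abs_self (q - node m)])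

/-- The nodes interlaced with the midpoints between consecutive nodes. -/
noncomputable def breakpoint (n : ℕ) : ℝ := (node (n / 2) + node ((n + 1) / 2)) / 2

theorem breakpoint_even (k : ℕ) : breakpoint (2 * k) = node k := by
  have h₁ : 2 * k / 2 = k := by omega
  have h₂ : (2 * k + 1) / 2 = k := by omega
  rw [breakpoint, h₁, h₂]
  ring

theorem breakpoint_odd (k : ℕ) : breakpoint (2 * k + 1) = (node k + node (k + 1)) / 2 := by
  have h₁ : (2 * k + 1) / 2 = k := by omega
  have h₂ : (2 * k + 1 + 1) / 2 = k + 1 := by omega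
  rw [breakpoint, h₁, h₂]

theorem breakpoint_odd_succ (k : ℕ) : breakpoint (2 * k + 1 + 1) = node (k + 1) :=
  breakpoint_even (k + 1)

theorem breakpoint_strictMono : StrictMono breakpoint := by
  refine strictMono_nat_of_lt_succ fun n => ?_
  obtain ⟨k, rfl | rfl⟩ := n.even_or_odd'
  · rw [breakpoint_even, breakpoint_odd]
    linarith [node_lt_succ k]
  · rw [breakpoint_odd, breakpoint_odd_succ]
    linarith [node_lt_succ k]

theorem tendsto_node : Tendsto node atTop atTop :=
  tendsto_atTop_mono le_node tendsto_natCast_atTop_atTop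

theorem tendsto_breakpoint : Tendsto breakpoint atTop atTop := by
  refine tendsto_atTop_atTop_of_monotone breakpoint_strictMono.monotone fun b => ?_
  obtain ⟨k, hk⟩ := (tendsto_node.eventually_ge_atTop b).exists
  exact ⟨2 * k, by rwa [breakpoint_even]⟩

theorem tent_eq_on_even {k : ℕ} {q : ℝ}
    (hq : q ∈ Set.Icc (breakpoint (2 * k)) (breakpoint (2 * k + 1))) :
    tent q = q - node k := by
  rw [breakpoint_even, breakpoint_odd] at hq
  have := node_lt_succ k
  rw [tent_eq_min hq.1 (by linarith [hq.2]), min_eq_left (by linarith [hq.2])]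

theorem tent_eq_on_odd {k : ℕ} {q : ℝ}
    (hq : q ∈ Set.Icc (breakpoint (2 * k + 1)) (breakpoint (2 * k + 1 + 1))) :
    tent q = node (k + 1) - q := by
  rw [breakpoint_odd_succ, breakpoint_odd] at hq
  have := node_lt_succ k
  rw [tent_eq_min (by linarith [hq.1]) hq.2, min_eq_right (by linarith [hq.1])]

theorem frequently_tent_eq_zero : ∃ᶠ q in atTop, tent q = 0 :=
  tendsto_node.frequently (Frequently.of_forall tent_node)

theorem frequently_mul_le_tent {b : ℝ} (hb : b < 1) : ∃ᶠ q in atTop, b * q ≤ tent q := by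
  have hmid : Tendsto (fun k => breakpoint (2 * k + 1)) atTop atTop :=
    tendsto_breakpoint.comp
      (tendsto_atTop_mono (fun k => by simp only [id]; omega) tendsto_id)
  refine hmid.frequently (Eventually.frequently ?_)
  have hlim : Tendsto (fun k : ℕ => (1 - b) * (k : ℝ)) atTop atTop :=
    tendsto_natCast_atTop_atTop.const_mul_atTop (by linarith)
  filter_upwards [hlim.eventually_ge_atTop (1 + b)] with k hk
  have hle := breakpoint_strictMono.monotone (Nat.le_succ (2 * k))
  rw [tent_eq_on_even ⟨hle, le_rfl⟩, breakpoint_odd, node_succ]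
  have h₀ := node_nonneg k
  have hk₀ : (0 : ℝ) ≤ k := Nat.cast_nonneg k
  nlinarith [mul_le_mul_of_nonneg_right hk h₀, mul_nonneg (sub_nonneg.2 hb.le) hk₀]

/-- The system whose top component is the identity and whose two lower components are
`3 * tent` apart. -/
noncomputable def system : Fin 3 → ℝ → ℝ :=
  ![fun q => (-q - 3 * tent q) / 2, fun q => (-q + 3 * tent q) / 2, fun q => q]

/-- The slopes of `system` between consecutive breakpoints. -/
noncomputable def slope (n : ℕ) : Fin 3 → ℝ :=
  if Even n then ![-2, 1, 1] else ![1, -2, 1]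

theorem slope_even (k : ℕ) : slope (2 * k) = ![-2, 1, 1] := by simp [slope]

theorem slope_odd (k : ℕ) : slope (2 * k + 1) = ![1, -2, 1] := by simp [slope]

theorem slope_odd_succ (k : ℕ) : slope (2 * k + 1 + 1) = ![-2, 1, 1] := slope_even (k + 1)

theorem isNSystem_system : IsNSystem 3 system := by
  have htent_zero : tent 0 = 0 := by simpa [node_zero] using tent_node 0
  refine ⟨breakpoint, slope, by simpa [node_zero] using breakpoint_even 0,
    breakpoint_strictMono, tendsto_breakpoint, ?_, ?_, ?_, ?_, ?_, ?_⟩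
  · intro j
    fin_cases j <;> simp [system, htent_zero]
  · intro n j
    obtain ⟨k, rfl | rfl⟩ := n.even_or_odd'
    · rw [slope_even]
      fin_cases j <;> norm_num
    · rw [slope_odd]
      fin_cases j <;> norm_num
  · intro n j q hq
    have hle := breakpoint_strictMono.monotone (Nat.le_succ n)
    obtain ⟨k, rfl | rfl⟩ := n.even_or_odd'
    · have h₁ := tent_eq_on_even hq
      have h₂ := tent_eq_on_even ⟨le_rfl, hle⟩
      rw [slope_even]
      fin_cases j <;> simp [system, h₁, h₂] <;> ring
    · have h₁ := tent_eq_on_odd hq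
      have h₂ := tent_eq_on_odd ⟨le_rfl, hle⟩
      rw [slope_odd]
      fin_cases j <;> simp [system, h₁, h₂] <;> ring
  · intro q hq i j hij
    have h₁ := tent_nonneg q
    have h₂ := tent_le_self hq
    fin_cases i <;> fin_cases j <;> simp [system] at hij ⊢ <;> linarith
  · intro q _
    simp only [Fin.sum_univ_three, system, Matrix.cons_val]
    ring
  · intro n i j
    obtain ⟨k, rfl | rfl⟩ := n.even_or_odd'
    · rw [slope_even, slope_odd]
      fin_cases i <;> fin_cases j <;> norm_num
    · rw [slope_odd, slope_odd_succ, breakpoint_odd_succ]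
      fin_cases i <;> fin_cases j <;> norm_num [system, tent_node]

end ZigzagSystem

/-- There exists a `3`-system `P = (P₁, P₂, P₃)` with
`liminf P₁(q)/q = -2`, `liminf P₂(q)/q = -1/2`, `liminf P₃(q)/q = 1`,
`limsup P₁(q)/q = -1/2`, `limsup P₂(q)/q = 1`, `limsup P₃(q)/q = 1`. -/
theorem exists_three_system_phibar_three_eq_one :
    ∃ P : Fin 3 → ℝ → ℝ, IsNSystem 3 P ∧
      liminf (fun q : ℝ => P 0 q / q) atTop = -2 ∧
      liminf (fun q : ℝ => P 1 q / q) atTop = -(1 / 2) ∧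
      liminf (fun q : ℝ => P 2 q / q) atTop = 1 ∧
      limsup (fun q : ℝ => P 0 q / q) atTop = -(1 / 2) ∧
      limsup (fun q : ℝ => P 1 q / q) atTop = 1 ∧
      limsup (fun q : ℝ => P 2 q / q) atTop = 1 := by
  have hpos : ∀ᶠ q : ℝ in atTop, 0 < q := eventually_gt_atTop 0
  have htop : (fun q : ℝ => ZigzagSystem.system 2 q / q) =ᶠ[atTop] fun _ => 1 := by
    filter_upwards [hpos] with q hq
    exact div_self hq.ne'
  refine ⟨ZigzagSystem.system, ZigzagSystem.isNSystem_system, ?_, ?_, ?_, ?_, ?_, ?_⟩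
  · refine liminf_eq_of_eventually_ge_of_frequently_le ?_ fun b hb => ?_
    · filter_upwards [hpos] with q hq
      rw [le_div_iff₀ hq]
      change _ ≤ (-q - 3 * ZigzagSystem.tent q) / 2
      linarith [ZigzagSystem.tent_le_self hq.le]
    · have hfreq :=
        ZigzagSystem.frequently_mul_le_tent (b := -(2 * b + 1) / 3) (by linarith)
      refine (hfreq.and_eventually hpos).mono ?_
      rintro q ⟨h, hq⟩
      rw [div_le_iff₀ hq]
      change (-q - 3 * ZigzagSystem.tent q) / 2 ≤ _
      linarith
  · refine liminf_eq_of_eventually_ge_of_frequently_le ?_ fun b hb => ?_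
    · filter_upwards [hpos] with q hq
      rw [le_div_iff₀ hq]
      change _ ≤ (-q + 3 * ZigzagSystem.tent q) / 2
      linarith [ZigzagSystem.tent_nonneg q]
    · refine (ZigzagSystem.frequently_tent_eq_zero.and_eventually hpos).mono ?_
      rintro q ⟨h, hq⟩
      rw [div_le_iff₀ hq]
      change (-q + 3 * ZigzagSystem.tent q) / 2 ≤ _
      rw [h]
      nlinarith
  · rw [liminf_congr htop, liminf_const]
  · refine limsup_eq_of_eventually_le_of_frequently_ge ?_ fun b hb => ?_
    · filter_upwards [hpos] with q hq
      rw [div_le_iff₀ hq]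
      change (-q - 3 * ZigzagSystem.tent q) / 2 ≤ _
      linarith [ZigzagSystem.tent_nonneg q]
    · refine (ZigzagSystem.frequently_tent_eq_zero.and_eventually hpos).mono ?_
      rintro q ⟨h, hq⟩
      rw [le_div_iff₀ hq]
      change _ ≤ (-q - 3 * ZigzagSystem.tent q) / 2
      rw [h]
      nlinarith
  · refine limsup_eq_of_eventually_le_of_frequently_ge ?_ fun b hb => ?_
    · filter_upwards [hpos] with q hq
      rw [div_le_iff₀ hq]
      change (-q + 3 * ZigzagSystem.tent q) / 2 ≤ _
      linarith [ZigzagSystem.tent_le_self hq.le]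
    · have hfreq :=
        ZigzagSystem.frequently_mul_le_tent (b := (2 * b + 1) / 3) (by linarith)
      refine (hfreq.and_eventually hpos).mono ?_
      rintro q ⟨h, hq⟩
      rw [le_div_iff₀ hq]
      change _ ≤ (-q + 3 * ZigzagSystem.tent q) / 2
      linarith
  · rw [limsup_congr htop, limsup_const]
end

section
/- There exists a 3-system P = (P₁,P₂,P₃) such that liminf_{q→∞} P₁(q)/q = −2, liminf_{q→∞} P₂(q)/q = −1/2, liminf_{q→∞} P₃(q)/q = 0, limsup_{q→∞} P₁(q)/q = 0, limsup_{q→∞} P₂(q)/q = 1, and limsup_{q→∞} P₃(q)/q = 1. -/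
open Filter

namespace ThreeSystem

/-- The points `0 = a 0 < a 1 < ⋯` at which all three components vanish; the ratios
`a (k + 1) / a k` are unbounded. -/
noncomputable def zeroPt (k : ℕ) : ℝ := k * (k.factorial : ℝ)

lemma zeroPt_zero : zeroPt 0 = 0 := by simp [zeroPt]

lemma zeroPt_succ_ge (k : ℕ) :
    zeroPt k + 1 ≤ zeroPt (k + 1) ∧ (k : ℝ) * zeroPt k ≤ zeroPt (k + 1) := by
  have h : (1 : ℝ) ≤ k.factorial := by exact_mod_cast k.factorial_pos
  have hk : (0 : ℝ) ≤ k := k.cast_nonneg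
  simp only [zeroPt, Nat.factorial_succ]
  push_cast
  constructor <;> nlinarith [mul_nonneg hk hk, mul_nonneg hk (zero_le_one.trans h),
    mul_nonneg (mul_nonneg hk hk) (zero_le_one.trans h)]

lemma zeroPt_strictMono : StrictMono zeroPt :=
  strictMono_nat_of_lt_succ fun k => by linarith [(zeroPt_succ_ge k).1]

lemma cast_le_zeroPt (k : ℕ) : (k : ℝ) ≤ zeroPt k := by
  induction k with
  | zero => simp [zeroPt]
  | succ k ih => push_cast; linarith [(zeroPt_succ_ge k).1]

lemma exists_lt_zeroPt_succ (q : ℝ) : ∃ k, q < zeroPt (k + 1) := by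
  obtain ⟨n, hn⟩ := exists_nat_gt q
  exact ⟨n, by linarith [cast_le_zeroPt n, (zeroPt_succ_ge n).1]⟩

open Classical in
/-- The index `k` with `a k ≤ q < a (k + 1)`. -/
noncomputable def idx (q : ℝ) : ℕ := Nat.find (exists_lt_zeroPt_succ q)

lemma idx_eq {k : ℕ} {q : ℝ} (h₁ : zeroPt k ≤ q) (h₂ : q < zeroPt (k + 1)) : idx q = k := by
  classical
  refine (Nat.find_eq_iff _).2 ⟨h₂, fun n hn h => ?_⟩
  linarith [zeroPt_strictMono.monotone (Nat.succ_le_of_lt hn)]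

lemma exists_mem_Icc {q : ℝ} (hq : 0 ≤ q) : ∃ k, zeroPt k ≤ q ∧ q ≤ zeroPt (k + 1) := by
  classical
  refine ⟨idx q, ?_, (Nat.find_spec (exists_lt_zeroPt_succ q)).le⟩
  rcases h : idx q with _ | n
  · simpa [zeroPt] using hq
  · exact not_lt.1 (Nat.find_min (exists_lt_zeroPt_succ q) (m := n) (by
      change n < idx q
      omega))

/-- The component with the smallest values, on a block `[a, b]`. -/
noncomputable def lowest (a b q : ℝ) : ℝ := max (2 * (a - q)) (q - b)

/-- The component with the largest values, on a block `[a, b]`. -/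
noncomputable def highest (a b q : ℝ) : ℝ := min (q - a) (2 * (b - q))

/-- The three components on a block `[a, b]`. -/
noncomputable def block (a b : ℝ) (j : Fin 3) (q : ℝ) : ℝ :=
  ![lowest a b q, -lowest a b q - highest a b q, highest a b q] j

/-- The `3`-system obtained by concatenating the blocks `[a k, a (k + 1)]`. -/
noncomputable def sys (j : Fin 3) (q : ℝ) : ℝ :=
  block (zeroPt (idx q)) (zeroPt (idx q + 1)) j q

lemma block_left {a b : ℝ} (h : a ≤ b) (j : Fin 3) : block a b j a = 0 := by
  fin_cases j <;> simp [block, lowest, highest, h]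

lemma block_right {a b : ℝ} (h : a ≤ b) (j : Fin 3) : block a b j b = 0 := by
  have h' : 2 * (a - b) ≤ 0 := by linarith
  fin_cases j <;> simp [block, lowest, highest, h, h']

lemma sys_eq {k : ℕ} {q : ℝ} (h₁ : zeroPt k ≤ q) (h₂ : q ≤ zeroPt (k + 1)) (j : Fin 3) :
    sys j q = block (zeroPt k) (zeroPt (k + 1)) j q := by
  rcases h₂.lt_or_eq with h | rfl
  · rw [sys, idx_eq h₁ h]
  · rw [sys, idx_eq le_rfl (zeroPt_strictMono (Nat.lt_succ_self _)),
      block_left (zeroPt_strictMono (Nat.lt_succ_self _)).le, block_right h₁]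

lemma sys_zeroPt (k : ℕ) (j : Fin 3) : sys j (zeroPt k) = 0 := by
  have h := (zeroPt_strictMono (Nat.lt_succ_self k)).le
  rw [sys_eq le_rfl h, block_left h]

lemma block_first {a b q : ℝ} (h₁ : a ≤ q) (h₂ : q ≤ (2 * a + b) / 3) :
    block a b 0 q = 2 * (a - q) ∧ block a b 1 q = q - a ∧ block a b 2 q = q - a := by
  have e₁ : lowest a b q = 2 * (a - q) := max_eq_left (by linarith)
  have e₂ : highest a b q = q - a := min_eq_left (by linarith)
  simp only [block, e₁, e₂, Matrix.cons_val]
  refine ⟨trivial, by ring, trivial⟩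

lemma block_second {a b q : ℝ} (h₁ : (2 * a + b) / 3 ≤ q) (h₂ : q ≤ (a + 2 * b) / 3) :
    block a b 0 q = q - b ∧ block a b 1 q = a + b - 2 * q ∧ block a b 2 q = q - a := by
  have e₁ : lowest a b q = q - b := max_eq_right (by linarith)
  have e₂ : highest a b q = q - a := min_eq_left (by linarith)
  simp only [block, e₁, e₂, Matrix.cons_val]
  refine ⟨trivial, by ring, trivial⟩

lemma block_third {a b q : ℝ} (h₁ : (a + 2 * b) / 3 ≤ q) (h₂ : q ≤ b) :
    block a b 0 q = q - b ∧ block a b 1 q = q - b ∧ block a b 2 q = 2 * (b - q) := by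
  have e₁ : lowest a b q = q - b := max_eq_right (by linarith)
  have e₂ : highest a b q = 2 * (b - q) := min_eq_right (by linarith)
  simp only [block, e₁, e₂, Matrix.cons_val]
  refine ⟨trivial, by ring, trivial⟩

lemma sys_order {q : ℝ} (hq : 0 ≤ q) :
    sys 0 q ≤ sys 1 q ∧ sys 1 q ≤ sys 2 q ∧ sys 0 q + sys 1 q + sys 2 q = 0 ∧
      -2 * q ≤ sys 0 q ∧ sys 2 q ≤ q := by
  obtain ⟨k, h₁, h₂⟩ := exists_mem_Icc hq
  have h₀ : 0 ≤ zeroPt k := k.cast_nonneg.trans (cast_le_zeroPt k)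
  simp only [sys_eq h₁ h₂]
  rcases le_total q ((2 * zeroPt k + zeroPt (k + 1)) / 3) with h | h
  · obtain ⟨e₀, e₁, e₂⟩ := block_first h₁ h
    rw [e₀, e₁, e₂]
    refine ⟨?_, ?_, ?_, ?_, ?_⟩ <;> linarith
  rcases le_total q ((zeroPt k + 2 * zeroPt (k + 1)) / 3) with h' | h'
  · obtain ⟨e₀, e₁, e₂⟩ := block_second h h'
    rw [e₀, e₁, e₂]
    refine ⟨?_, ?_, ?_, ?_, ?_⟩ <;> linarith
  · obtain ⟨e₀, e₁, e₂⟩ := block_third h' h₂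
    rw [e₀, e₁, e₂]
    refine ⟨?_, ?_, ?_, ?_, ?_⟩ <;> linarith

/-- The breakpoints: every block is cut into three equal parts. -/
noncomputable def breakPt (m : ℕ) : ℝ :=
  zeroPt (m / 3) + (m % 3 : ℕ) * ((zeroPt (m / 3 + 1) - zeroPt (m / 3)) / 3)

lemma breakPt_mul (k : ℕ) : breakPt (3 * k) = zeroPt k := by
  simp [breakPt]

lemma breakPt_mul_add_one (k : ℕ) :
    breakPt (3 * k + 1) = (2 * zeroPt k + zeroPt (k + 1)) / 3 := by
  have h₁ : (3 * k + 1) / 3 = k := by omega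
  have h₂ : (3 * k + 1) % 3 = 1 := by omega
  rw [breakPt, h₁, h₂]
  push_cast
  ring

lemma breakPt_mul_add_two (k : ℕ) :
    breakPt (3 * k + 2) = (zeroPt k + 2 * zeroPt (k + 1)) / 3 := by
  have h₁ : (3 * k + 2) / 3 = k := by omega
  have h₂ : (3 * k + 2) % 3 = 2 := by omega
  rw [breakPt, h₁, h₂]
  push_cast
  ring

lemma breakPt_mul_add_three (k : ℕ) : breakPt (3 * k + 2 + 1) = zeroPt (k + 1) :=
  breakPt_mul (k + 1)

lemma exists_eq_mul_three_add (m : ℕ) : ∃ k, m = 3 * k ∨ m = 3 * k + 1 ∨ m = 3 * k + 2 :=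
  ⟨m / 3, by omega⟩

lemma breakPt_strictMono : StrictMono breakPt := by
  refine strictMono_nat_of_lt_succ fun m => ?_
  obtain ⟨k, rfl | rfl | rfl⟩ := exists_eq_mul_three_add m
  · rw [breakPt_mul, breakPt_mul_add_one]
    linarith [(zeroPt_succ_ge k).1]
  · rw [breakPt_mul_add_one, breakPt_mul_add_two]
    linarith [(zeroPt_succ_ge k).1]
  · rw [breakPt_mul_add_two, breakPt_mul_add_three]
    linarith [(zeroPt_succ_ge k).1]

lemma breakPt_tendsto : Tendsto breakPt atTop atTop := by
  refine tendsto_atTop_atTop_of_monotone breakPt_strictMono.monotone fun b => ?_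
  obtain ⟨n, hn⟩ := exists_nat_ge b
  exact ⟨3 * n, by rw [breakPt_mul]; exact hn.trans (cast_le_zeroPt n)⟩

/-- The slopes: the components decrease in turn. -/
noncomputable def slope (m : ℕ) (j : Fin 3) : ℝ := if m % 3 = j then -2 else 1

lemma slope_eq_neg_two {m : ℕ} {j : Fin 3} (h : slope m j = -2) : m % 3 = j := by
  by_contra hne
  norm_num [slope, hne] at h

lemma sys_affine (m : ℕ) (j : Fin 3) {q : ℝ}
    (hq : q ∈ Set.Icc (breakPt m) (breakPt (m + 1))) :
    sys j q = sys j (breakPt m) + slope m j * (q - breakPt m) := by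
  obtain ⟨hl, hr⟩ := hq
  obtain ⟨k, rfl | rfl | rfl⟩ := exists_eq_mul_three_add m
  all_goals have hk := (zeroPt_succ_ge k).1
  · rw [breakPt_mul] at hl ⊢
    rw [breakPt_mul_add_one] at hr
    obtain ⟨e₀, e₁, e₂⟩ := block_first hl hr
    rw [sys_zeroPt, sys_eq hl (by linarith)]
    have h : (3 * k) % 3 = 0 := by omega
    fin_cases j <;> simp [slope, h, e₀, e₁, e₂]; ring
  · rw [breakPt_mul_add_one] at hl ⊢
    rw [breakPt_mul_add_two] at hr
    obtain ⟨e₀, e₁, e₂⟩ := block_second hl hr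
    obtain ⟨d₀, d₁, d₂⟩ := block_second (a := zeroPt k) (b := zeroPt (k + 1)) le_rfl
      (by linarith)
    rw [sys_eq (k := k) (by linarith) (by linarith),
      sys_eq (k := k) (q := (2 * zeroPt k + zeroPt (k + 1)) / 3) (by linarith) (by linarith)]
    have h : (3 * k + 1) % 3 = 1 := by omega
    fin_cases j <;> simp [slope, h, e₀, e₁, e₂, d₀, d₁, d₂]; ring
  · rw [breakPt_mul_add_two] at hl ⊢
    rw [breakPt_mul_add_three] at hr
    obtain ⟨e₀, e₁, e₂⟩ := block_third hl hr
    obtain ⟨d₀, d₁, d₂⟩ := block_third (a := zeroPt k) (b := zeroPt (k + 1)) le_rfl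
      (by linarith)
    rw [sys_eq (k := k) (by linarith) (by linarith),
      sys_eq (k := k) (q := (zeroPt k + 2 * zeroPt (k + 1)) / 3) (by linarith) (by linarith)]
    have h : (3 * k + 2) % 3 = 2 := by omega
    fin_cases j <;> simp [slope, h, e₀, e₁, e₂, d₀, d₁, d₂]; ring

lemma isNSystem_sys : IsNSystem 3 sys := by
  have hn : -(((3 : ℕ) : ℝ) - 1) = -2 := by norm_num
  refine ⟨breakPt, slope, (breakPt_mul 0).trans zeroPt_zero, breakPt_strictMono,
    breakPt_tendsto, fun j => ?_, fun m j => ?_, fun m j q hq => sys_affine m j hq,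
    fun q hq i j hij => ?_, fun q hq => ?_, fun m i j hi _ _ hj => ?_⟩
  · simpa only [zeroPt_zero] using sys_zeroPt 0 j
  · rw [hn, slope]
    split_ifs <;> simp
  · obtain ⟨h₁, h₂, -⟩ := sys_order hq
    fin_cases i <;> fin_cases j <;> first
      | exact le_rfl
      | exact h₁
      | exact h₂
      | exact h₁.trans h₂
      | exact absurd hij (by decide)
  · rw [Fin.sum_univ_three]
    exact (sys_order hq).2.2.1
  · rw [hn] at hi hj
    have hi := slope_eq_neg_two hi
    have hj := slope_eq_neg_two hj
    obtain ⟨k, rfl | rfl | rfl⟩ := exists_eq_mul_three_add m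
    · left; omega
    · left; omega
    · right
      rw [breakPt_mul_add_three, sys_zeroPt, sys_zeroPt]

lemma liminf_eq_of_frequently_le {f : ℝ → ℝ} {c : ℝ} (h₁ : ∀ q, 0 < q → c ≤ f q)
    (h₂ : ∀ ε > 0, ∃ᶠ q in atTop, f q ≤ c + ε) : liminf f atTop = c := by
  have h : ∀ᶠ q in atTop, c ≤ f q := (eventually_gt_atTop 0).mono h₁
  refine le_antisymm (le_of_forall_pos_le_add fun ε hε => ?_) ?_
  · exact liminf_le_of_frequently_le (h₂ ε hε) (isBoundedUnder_of_eventually_ge h)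
  · exact le_liminf_of_le (IsCoboundedUnder.of_frequently_le (h₂ 1 one_pos)) h

lemma limsup_eq_of_frequently_ge {f : ℝ → ℝ} {c : ℝ} (h₁ : ∀ q, 0 < q → f q ≤ c)
    (h₂ : ∀ ε > 0, ∃ᶠ q in atTop, c - ε ≤ f q) : limsup f atTop = c := by
  have h : ∀ᶠ q in atTop, f q ≤ c := (eventually_gt_atTop 0).mono h₁
  refine le_antisymm ?_ (le_of_forall_sub_le fun ε hε => ?_)
  · exact limsup_le_of_le (IsCoboundedUnder.of_frequently_ge (h₂ 1 one_pos)) h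
  · exact le_limsup_of_frequently_le (h₂ ε hε) (isBoundedUnder_of_eventually_le h)

/-- To show that a property holds at arbitrarily large points, it suffices to find such a point
in every block `[a k, a (k + 1)]` with `a k / a (k + 1)` small. -/
lemma frequently_of_block {p : ℝ → Prop} {ε : ℝ} (hε : 0 < ε)
    (h : ∀ k, 0 < zeroPt k → 6 * zeroPt k ≤ ε * zeroPt (k + 1) →
      ∃ q, zeroPt k ≤ q ∧ p q) : ∃ᶠ q in atTop, p q := by
  refine frequently_atTop.2 fun N => ?_
  obtain ⟨k, hk⟩ := exists_nat_ge (max N (max 1 (6 / ε)))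
  simp only [max_le_iff] at hk
  obtain ⟨hN, h1, h6⟩ := hk
  have hc := cast_le_zeroPt k
  have h0 : 0 < zeroPt k := by linarith
  rw [div_le_iff₀ hε] at h6
  obtain ⟨q, hq, hp⟩ := h k h0 (by nlinarith [(zeroPt_succ_ge k).2])
  exact ⟨q, by linarith, hp⟩

lemma frequently_sys_div_eq_zero (j : Fin 3) : ∃ᶠ q in atTop, sys j q / q = 0 :=
  frequently_of_block one_pos fun k _ _ => ⟨zeroPt k, le_rfl, by simp [sys_zeroPt]⟩

lemma sys_at_first (k : ℕ) :
    let q := (2 * zeroPt k + zeroPt (k + 1)) / 3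
    sys 0 q = 2 * (zeroPt k - q) ∧ sys 1 q = q - zeroPt k ∧ sys 2 q = q - zeroPt k := by
  have hk := (zeroPt_succ_ge k).1
  simp only
  rw [sys_eq (k := k) (by linarith) (by linarith), sys_eq (k := k) (by linarith) (by linarith),
    sys_eq (k := k) (by linarith) (by linarith)]
  exact block_first (by linarith) le_rfl

lemma sys_one_at_second (k : ℕ) :
    let q := (zeroPt k + 2 * zeroPt (k + 1)) / 3
    sys 1 q = q - zeroPt (k + 1) := by
  have hk := (zeroPt_succ_ge k).1
  simp only
  rw [sys_eq (k := k) (by linarith) (by linarith)]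
  exact (block_third le_rfl (by linarith)).2.1

end ThreeSystem

open ThreeSystem in
/-- There exists a `3`-system `P = (P₁, P₂, P₃)` with
`liminf P₁(q)/q = -2`, `liminf P₂(q)/q = -1/2`, `liminf P₃(q)/q = 0`,
`limsup P₁(q)/q = 0`, `limsup P₂(q)/q = 1`, `limsup P₃(q)/q = 1`. -/
theorem exists_three_system_phibar_one_eq_zero :
    ∃ P : Fin 3 → ℝ → ℝ, IsNSystem 3 P ∧
      liminf (fun q : ℝ => P 0 q / q) atTop = -2 ∧
      liminf (fun q : ℝ => P 1 q / q) atTop = -(1 / 2) ∧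
      liminf (fun q : ℝ => P 2 q / q) atTop = 0 ∧
      limsup (fun q : ℝ => P 0 q / q) atTop = 0 ∧
      limsup (fun q : ℝ => P 1 q / q) atTop = 1 ∧
      limsup (fun q : ℝ => P 2 q / q) atTop = 1 := by
  refine ⟨sys, isNSystem_sys, liminf_eq_of_frequently_le (fun q hq => ?_) fun ε hε => ?_,
    liminf_eq_of_frequently_le (fun q hq => ?_) fun ε hε => ?_,
    liminf_eq_of_frequently_le (fun q hq => ?_) fun ε hε => ?_,
    limsup_eq_of_frequently_ge (fun q hq => ?_) fun ε hε => ?_,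
    limsup_eq_of_frequently_ge (fun q hq => ?_) fun ε hε => ?_,
    limsup_eq_of_frequently_ge (fun q hq => ?_) fun ε hε => ?_⟩
  · rw [le_div_iff₀ hq]
    linarith [sys_order hq.le]
  · refine frequently_of_block hε fun k h0 h =>
      ⟨(2 * zeroPt k + zeroPt (k + 1)) / 3, ?_, ?_⟩
    · linarith [(zeroPt_succ_ge k).1]
    · rw [(sys_at_first k).1, div_le_iff₀ (by linarith [(zeroPt_succ_ge k).1])]
      nlinarith
  · rw [le_div_iff₀ hq]
    linarith [sys_order hq.le]
  · refine frequently_of_block hε fun k h0 h =>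
      ⟨(zeroPt k + 2 * zeroPt (k + 1)) / 3, ?_, ?_⟩
    · linarith [(zeroPt_succ_ge k).1]
    · rw [sys_one_at_second k, div_le_iff₀ (by linarith [(zeroPt_succ_ge k).1])]
      nlinarith
  · rw [le_div_iff₀ hq]
    linarith [sys_order hq.le]
  · exact (frequently_sys_div_eq_zero 2).mono fun q h => by linarith
  · rw [div_le_iff₀ hq]
    linarith [sys_order hq.le]
  · exact (frequently_sys_div_eq_zero 0).mono fun q h => by linarith
  · rw [div_le_iff₀ hq]
    linarith [sys_order hq.le]
  · refine frequently_of_block hε fun k h0 h =>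
      ⟨(2 * zeroPt k + zeroPt (k + 1)) / 3, ?_, ?_⟩
    · linarith [(zeroPt_succ_ge k).1]
    · rw [(sys_at_first k).2.1, le_div_iff₀ (by linarith [(zeroPt_succ_ge k).1])]
      nlinarith
  · rw [div_le_iff₀ hq]
    linarith [sys_order hq.le]
  · refine frequently_of_block hε fun k h0 h =>
      ⟨(2 * zeroPt k + zeroPt (k + 1)) / 3, ?_, ?_⟩
    · linarith [(zeroPt_succ_ge k).1]
    · rw [(sys_at_first k).2.2, le_div_iff₀ (by linarith [(zeroPt_succ_ge k).1])]
      nlinarith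
end

section
/- For every integer n ≥ 3 there exists an n-system P = (P₁,…,Pₙ) such that liminf_{q→∞} P₁(q)/q = −(n−1), liminf_{q→∞} P₂(q)/q = (2−n)/2, liminf_{q→∞} P_j(q)/q = 1 for every j with 3 ≤ j ≤ n, limsup_{q→∞} P₁(q)/q = (2−n)/2, and limsup_{q→∞} P_j(q)/q = 1 for every j with 2 ≤ j ≤ n. -/
open Filter

theorem limsup_eq_of_eventually_le_of_tendsto_comp {f : ℝ → ℝ} {L m : ℝ} {s : ℕ → ℝ}
    (hle : ∀ᶠ q in atTop, f q ≤ L) (hge : ∀ᶠ q in atTop, m ≤ f q)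
    (hs : Tendsto s atTop atTop) (hf : Tendsto (f ∘ s) atTop (nhds L)) :
    limsup f atTop = L := by
  apply le_antisymm
  · exact limsup_le_of_le (isCoboundedUnder_le_of_eventually_le atTop hge) hle
  · have h : limsup f (map s atTop) ≤ limsup f atTop :=
      limsup_le_limsup_of_le hs
        (isCoboundedUnder_le_of_eventually_le _ (hs.eventually hge)) ⟨L, hle⟩
    exact hf.limsup_eq.symm.le.trans h

theorem liminf_eq_of_eventually_ge_of_tendsto_comp {f : ℝ → ℝ} {L M : ℝ} {s : ℕ → ℝ}
    (hge : ∀ᶠ q in atTop, L ≤ f q) (hle : ∀ᶠ q in atTop, f q ≤ M)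
    (hs : Tendsto s atTop atTop) (hf : Tendsto (f ∘ s) atTop (nhds L)) :
    liminf f atTop = L := by
  apply le_antisymm
  · have h : liminf f atTop ≤ liminf f (map s atTop) :=
      liminf_le_liminf_of_le hs ⟨L, hge⟩
        (isCoboundedUnder_ge_of_eventually_le _ (hs.eventually hle))
    exact h.trans hf.liminf_eq.le
  · exact le_liminf_of_le (isCoboundedUnder_ge_of_eventually_le atTop hle) hge

namespace Zigzag

/-- The zeros of the zigzag function. -/
noncomputable def zero (k : ℕ) : ℝ := k * k.factorial

/-- The breakpoints of the zigzag function: its zeros and the midpoints between them. -/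
noncomputable def node (k : ℕ) : ℝ := (zero (k / 2) + zero ((k + 1) / 2)) / 2

/-- The distance to the set of zeros, a piecewise linear function with slopes `±1`. -/
noncomputable def height (q : ℝ) : ℝ := Metric.infDist q (Set.range zero)

theorem zero_zero : zero 0 = 0 := by simp [zero]

theorem succ_mul_zero_le (k : ℕ) : (k + 1) * zero k ≤ zero (k + 1) := by
  have h : (0 : ℝ) < k.factorial := by positivity
  simp only [zero, Nat.factorial_succ]
  push_cast
  nlinarith [mul_nonneg (Nat.cast_nonneg (α := ℝ) k) h.le]

theorem zero_strictMono : StrictMono zero := by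
  refine strictMono_nat_of_lt_succ fun k => ?_
  have h : (0 : ℝ) < k.factorial := by positivity
  simp only [zero, Nat.factorial_succ]
  push_cast
  nlinarith [mul_nonneg (Nat.cast_nonneg (α := ℝ) k) h.le,
    mul_nonneg (mul_nonneg (Nat.cast_nonneg (α := ℝ) k) (Nat.cast_nonneg (α := ℝ) k)) h.le]

theorem cast_le_zero (k : ℕ) : (k : ℝ) ≤ zero k := by
  have h : (1 : ℝ) ≤ k.factorial := by exact_mod_cast k.factorial_pos
  simp only [zero]
  nlinarith [Nat.cast_nonneg (α := ℝ) k]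

theorem tendsto_zero : Tendsto zero atTop atTop :=
  tendsto_atTop_mono cast_le_zero tendsto_natCast_atTop_atTop

theorem node_two_mul (k : ℕ) : node (2 * k) = zero k := by
  have h1 : 2 * k / 2 = k := by omega
  have h2 : (2 * k + 1) / 2 = k := by omega
  rw [node, h1, h2]
  ring

theorem node_two_mul_add_one (k : ℕ) :
    node (2 * k + 1) = (zero k + zero (k + 1)) / 2 := by
  have h1 : (2 * k + 1) / 2 = k := by omega
  have h2 : (2 * k + 1 + 1) / 2 = k + 1 := by omega
  rw [node, h1, h2]

theorem node_strictMono : StrictMono node := by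
  refine strictMono_nat_of_lt_succ fun k => ?_
  obtain ⟨m, rfl | rfl⟩ := k.even_or_odd'
  · rw [node_two_mul, node_two_mul_add_one]
    linarith [zero_strictMono m.lt_succ_self]
  · rw [show 2 * m + 1 + 1 = 2 * (m + 1) by ring, node_two_mul, node_two_mul_add_one]
    linarith [zero_strictMono m.lt_succ_self]

theorem tendsto_node : Tendsto node atTop atTop := by
  refine tendsto_atTop_mono (fun k => ?_)
    (tendsto_zero.comp (Nat.tendsto_div_const_atTop two_ne_zero))
  have h : zero (k / 2) ≤ zero ((k + 1) / 2) := zero_strictMono.monotone (by omega)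
  simp only [Function.comp, node]
  linarith

theorem height_nonneg (q : ℝ) : 0 ≤ height q := Metric.infDist_nonneg

theorem height_le {q : ℝ} (hq : 0 ≤ q) : height q ≤ q := by
  have h := Metric.infDist_le_dist_of_mem (x := q) (Set.mem_range_self (f := zero) 0)
  rwa [zero_zero, Real.dist_eq, sub_zero, abs_of_nonneg hq] at h

theorem height_zero (k : ℕ) : height (zero k) = 0 :=
  Metric.infDist_zero_of_mem (Set.mem_range_self k)

theorem height_eq_min {k : ℕ} {q : ℝ} (h1 : zero k ≤ q) (h2 : q ≤ zero (k + 1)) :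
    height q = min (q - zero k) (zero (k + 1) - q) := by
  apply le_antisymm
  · refine le_min ?_ ?_
    · have h := Metric.infDist_le_dist_of_mem (x := q) (Set.mem_range_self (f := zero) k)
      rwa [Real.dist_eq, abs_of_nonneg (by linarith)] at h
    · have h := Metric.infDist_le_dist_of_mem (x := q) (Set.mem_range_self (f := zero) (k + 1))
      rwa [Real.dist_eq, abs_of_nonpos (by linarith), neg_sub] at h
  · refine (Metric.le_infDist (Set.range_nonempty zero)).2 ?_
    rintro _ ⟨m, rfl⟩
    rw [Real.dist_eq]
    rcases Nat.lt_or_ge k m with h | h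
    · have := zero_strictMono.monotone (show k + 1 ≤ m from h)
      exact (min_le_right _ _).trans (by linarith [neg_le_abs (q - zero m)])
    · have := zero_strictMono.monotone h
      exact (min_le_left _ _).trans (by linarith [le_abs_self (q - zero m)])

theorem height_eq_on_Icc (k : ℕ) {q : ℝ} (hq : q ∈ Set.Icc (node k) (node (k + 1))) :
    height q = height (node k) + (if Even k then 1 else -1) * (q - node k) := by
  obtain ⟨m, rfl | rfl⟩ := k.even_or_odd'
  · rw [node_two_mul, node_two_mul_add_one] at hq
    have h := zero_strictMono m.lt_succ_self
    rw [if_pos (even_two_mul m), node_two_mul, height_zero,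
      height_eq_min hq.1 (by linarith [hq.2]), min_eq_left (by linarith [hq.2])]
    ring
  · rw [show 2 * m + 1 + 1 = 2 * (m + 1) by ring, node_two_mul, node_two_mul_add_one] at hq
    have h := zero_strictMono m.lt_succ_self
    rw [if_neg (by simp), node_two_mul_add_one,
      height_eq_min (by linarith [hq.1]) hq.2, min_eq_right (by linarith [hq.1]),
      height_eq_min (k := m) (by linarith) (by linarith), min_eq_right (by linarith)]
    ring

theorem tendsto_height_div_peak :
    Tendsto (fun k => height (node (2 * k + 1)) / node (2 * k + 1)) atTop (nhds 1) := by
  have hlow : Tendsto (fun k : ℕ => 1 - 2 * (1 / ((k : ℝ) + 1))) atTop (nhds 1) := by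
    simpa using (tendsto_one_div_add_atTop_nhds_zero_nat (𝕜 := ℝ)).const_mul 2 |>.const_sub 1
  refine tendsto_of_tendsto_of_tendsto_of_le_of_le hlow tendsto_const_nhds (fun k => ?_)
    (fun k => ?_)
  · have h := zero_strictMono k.lt_succ_self
    have h0 : 0 ≤ zero k := (Nat.cast_nonneg k).trans (cast_le_zero k)
    have hk : (0 : ℝ) < k + 1 := by positivity
    have hs := succ_mul_zero_le k
    have hz : zero k ≤ zero (k + 1) * (1 / ((k : ℝ) + 1)) := by
      rw [mul_one_div, le_div_iff₀ hk]
      linarith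
    have hp : 0 ≤ 1 / ((k : ℝ) + 1) := by positivity
    simp only [node_two_mul_add_one]
    rw [height_eq_min (k := k) (by linarith) (by linarith), min_eq_right (by linarith),
      le_div_iff₀ (by linarith)]
    nlinarith [mul_nonneg h0 hp]
  · have h : 0 ≤ node (2 * k + 1) := by
      rw [node_two_mul_add_one]
      linarith [cast_le_zero k, cast_le_zero (k + 1), Nat.cast_nonneg (α := ℝ) k,
        Nat.cast_nonneg (α := ℝ) (k + 1)]
    exact div_le_one_of_le₀ (height_le h) h

theorem tendsto_node_two_mul_add_one :
    Tendsto (fun k => node (2 * k + 1)) atTop atTop :=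
  tendsto_node.comp (tendsto_atTop_mono (fun k => show k ≤ 2 * k + 1 by omega) tendsto_id)

/-- The system whose first two components differ by `n` times the zigzag function, all other
components being the identity. -/
noncomputable def system (n : ℕ) (j : Fin n) (q : ℝ) : ℝ :=
  if (j : ℕ) = 0 then (-(n * height q) - (n - 2) * q) / 2
  else if (j : ℕ) = 1 then (n * height q - (n - 2) * q) / 2
  else q

/-- The slope of the `j`-th component of `system` on the `k`-th interval. -/
noncomputable def slope (n : ℕ) (k : ℕ) (j : Fin n) : ℝ :=
  if (j : ℕ) = 0 then (if Even k then -((n : ℝ) - 1) else 1)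
  else if (j : ℕ) = 1 then (if Even k then 1 else -((n : ℝ) - 1))
  else 1

theorem sum_system {n : ℕ} (hn : 2 ≤ n) (q : ℝ) : ∑ j, system n j q = 0 := by
  obtain ⟨m, rfl⟩ := Nat.exists_eq_add_of_le' hn
  simp [Fin.sum_univ_succ, system]
  ring

theorem system_le_system {n : ℕ} {q : ℝ} (hq : 0 ≤ q) {i j : Fin n} (hij : i ≤ j) :
    system n i q ≤ system n j q := by
  have hij' : (i : ℕ) ≤ j := hij
  have h1 := mul_nonneg (Nat.cast_nonneg (α := ℝ) n) (height_nonneg q)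
  have h2 := mul_le_mul_of_nonneg_left (height_le hq) (Nat.cast_nonneg (α := ℝ) n)
  unfold system
  split_ifs <;> first | omega | nlinarith

theorem isNSystem_system {n : ℕ} (hn : 2 ≤ n) : IsNSystem n (system n) := by
  have hn0 : (2 : ℝ) ≤ n := by exact_mod_cast hn
  have hb0 : node 0 = 0 := by simpa [zero_zero] using node_two_mul 0
  have hh0 : height 0 = 0 := by simpa [zero_zero] using height_zero 0
  refine ⟨node, slope n, hb0, node_strictMono, tendsto_node, ?_, ?_, ?_,
    fun q hq i j => system_le_system hq, fun q _ => sum_system hn q, ?_⟩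
  · intro j
    simp [system, hh0]
  · intro k j
    unfold slope
    split_ifs <;> simp
  · intro k j q hq
    have h := height_eq_on_Icc k hq
    unfold system slope
    split_ifs at h ⊢ <;> first | (rw [h]; ring) | ring
  · intro k i j hi hi' hj hj'
    have hne : (1 : ℝ) ≠ -((n : ℝ) - 1) := by
      intro h
      linarith
    unfold slope at hi hi' hj hj'
    by_cases hk : Even k
    · have hk' : ¬ Even (k + 1) := by simpa [Nat.even_add_one] using hk
      left
      rw [Fin.lt_def]
      simp only [hk, hk', if_true, if_false] at hi hi' hj hj'
      split_ifs at hi hj' <;> first | omega | exact absurd hi hne | exact absurd hj' hne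
    · have hk' : Even (k + 1) := by simpa [Nat.even_add_one] using hk
      right
      have hz : height (node (k + 1)) = 0 := by
        obtain ⟨m, hm⟩ := hk'.two_dvd
        rw [hm, node_two_mul, height_zero]
      simp only [hk, hk', if_true, if_false] at hi hi' hj hj'
      unfold system
      rw [hz]
      split_ifs at hi hj' ⊢ <;> first | exact absurd hi hne | exact absurd hj' hne | simp

end Zigzag

open Zigzag in
/-- For every integer `n ≥ 3` there exists an `n`-system `P = (P₁, …, Pₙ)`
(indexed here by `Fin n`, so `Pⱼ = P ⟨j-1, _⟩`) with
`liminf P₁(q)/q = -(n-1)`, `liminf P₂(q)/q = (2-n)/2`, `liminf Pⱼ(q)/q = 1` for `3 ≤ j ≤ n`,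
`limsup P₁(q)/q = (2-n)/2`, and `limsup Pⱼ(q)/q = 1` for `2 ≤ j ≤ n`. -/
theorem exists_n_system_phibar_n_eq_one (n : ℕ) (hn : 3 ≤ n) :
    ∃ P : Fin n → ℝ → ℝ, IsNSystem n P ∧
      liminf (fun q : ℝ => P ⟨0, by omega⟩ q / q) atTop = -((n : ℝ) - 1) ∧
      liminf (fun q : ℝ => P ⟨1, by omega⟩ q / q) atTop = (2 - (n : ℝ)) / 2 ∧
      (∀ j : Fin n, 2 ≤ (j : ℕ) → liminf (fun q : ℝ => P j q / q) atTop = 1) ∧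
      limsup (fun q : ℝ => P ⟨0, by omega⟩ q / q) atTop = (2 - (n : ℝ)) / 2 ∧
      (∀ j : Fin n, 1 ≤ (j : ℕ) → limsup (fun q : ℝ => P j q / q) atTop = 1) := by
  have hn0 : (0 : ℝ) ≤ n := Nat.cast_nonneg n
  have hu : ∀ᶠ q : ℝ in atTop, 0 ≤ height q / q ∧ height q / q ≤ 1 := by
    filter_upwards [eventually_ge_atTop 0] with q hq
    exact ⟨div_nonneg (height_nonneg q) hq, div_le_one_of_le₀ (height_le hq) hq⟩
  have hzero : Tendsto (fun k => height (zero k) / zero k) atTop (nhds 0) := by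
    simp [height_zero]
  have h0 : (fun q : ℝ => system n ⟨0, by omega⟩ q / q) =ᶠ[atTop]
      fun q => (-(n * (height q / q)) - (n - 2)) / 2 := by
    filter_upwards [eventually_gt_atTop 0] with q hq
    simp only [system, if_true]
    field_simp
  have h1 : (fun q : ℝ => system n ⟨1, by omega⟩ q / q) =ᶠ[atTop]
      fun q => (n * (height q / q) - (n - 2)) / 2 := by
    filter_upwards [eventually_gt_atTop 0] with q hq
    simp only [system, one_ne_zero, if_true, if_false]
    field_simp
  have h2 : ∀ j : Fin n, 2 ≤ (j : ℕ) →
      Tendsto (fun q : ℝ => system n j q / q) atTop (nhds 1) := by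
    intro j hj
    refine tendsto_const_nhds.congr' ?_
    filter_upwards [eventually_gt_atTop 0] with q hq
    rw [system, if_neg (by omega), if_neg (by omega), div_self hq.ne']
  have c0 : ∀ {s : ℕ → ℝ} {u : ℝ}, Tendsto (fun k => height (s k) / s k) atTop (nhds u) →
      Tendsto ((fun q : ℝ => (-(n * (height q / q)) - (n - 2)) / 2) ∘ s) atTop
        (nhds ((-(n * u) - ((n : ℝ) - 2)) / 2)) := fun h =>
    (((h.const_mul (n : ℝ)).neg).sub_const _).div_const 2
  have c1 : ∀ {s : ℕ → ℝ} {u : ℝ}, Tendsto (fun k => height (s k) / s k) atTop (nhds u) →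
      Tendsto ((fun q : ℝ => (n * (height q / q) - (n - 2)) / 2) ∘ s) atTop
        (nhds ((n * u - ((n : ℝ) - 2)) / 2)) := fun h =>
    ((h.const_mul (n : ℝ)).sub_const _).div_const 2
  have b0 : ∀ᶠ q : ℝ in atTop, -((n : ℝ) - 1) ≤ (-(n * (height q / q)) - (n - 2)) / 2 ∧
      (-(n * (height q / q)) - (n - 2)) / 2 ≤ (2 - (n : ℝ)) / 2 := by
    filter_upwards [hu] with q hq
    constructor <;> nlinarith [mul_nonneg hn0 hq.1, mul_le_mul_of_nonneg_left hq.2 hn0]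
  have b1 : ∀ᶠ q : ℝ in atTop, (2 - (n : ℝ)) / 2 ≤ (n * (height q / q) - (n - 2)) / 2 ∧
      (n * (height q / q) - (n - 2)) / 2 ≤ 1 := by
    filter_upwards [hu] with q hq
    constructor <;> nlinarith [mul_nonneg hn0 hq.1, mul_le_mul_of_nonneg_left hq.2 hn0]
  refine ⟨system n, isNSystem_system (by omega), ?_, ?_, fun j hj => (h2 j hj).liminf_eq, ?_, ?_⟩
  · rw [liminf_congr h0]
    refine liminf_eq_of_eventually_ge_of_tendsto_comp (b0.mono fun _ h => h.1)
      (b0.mono fun _ h => h.2) tendsto_node_two_mul_add_one ?_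
    convert c0 tendsto_height_div_peak using 2
    ring
  · rw [liminf_congr h1]
    refine liminf_eq_of_eventually_ge_of_tendsto_comp (b1.mono fun _ h => h.1)
      (b1.mono fun _ h => h.2) tendsto_zero ?_
    convert c1 hzero using 2
    ring
  · rw [limsup_congr h0]
    refine limsup_eq_of_eventually_le_of_tendsto_comp (b0.mono fun _ h => h.2)
      (b0.mono fun _ h => h.1) tendsto_zero ?_
    convert c0 hzero using 2
    ring
  · intro j hj
    rcases hj.eq_or_lt with hj | hj
    · have hj1 : j = ⟨1, by omega⟩ := Fin.ext hj.symm
      rw [hj1, limsup_congr h1]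
      refine limsup_eq_of_eventually_le_of_tendsto_comp (b1.mono fun _ h => h.2)
        (b1.mono fun _ h => h.1) tendsto_node_two_mul_add_one ?_
      convert c1 tendsto_height_div_peak using 2
      ring
    · exact (h2 j hj).limsup_eq
end

section
/- For every integer n ≥ 3 there exists an n-system P = (P₁,…,Pₙ) such that liminf_{q→∞} P₁(q)/q = −(n−1), liminf_{q→∞} P₂(q)/q = (2−n)/2, liminf_{q→∞} P_j(q)/q = 0 for every j with 3 ≤ j ≤ n, limsup_{q→∞} P₁(q)/q = 0, and limsup_{q→∞} P_j(q)/q = 1 for every j with 2 ≤ j ≤ n. -/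
open Filter

/-- Row lengths of a `(p + 2)`-row Young diagram after adding `s` boxes to the rectangle with rows
of length `a`: first `d` boxes in row `0`, then `d` boxes in row `1`, and then the remaining
rows are filled column by column. -/
def phaseRow (p a d s : ℕ) : ℕ → ℕ
  | 0 => a + min s d
  | 1 => a + min (s - d) d
  | l + 2 => a + (s - 2 * d + (p - 1 - l)) / p

/-- The common row length of the rectangle at the start of the `m`-th phase. -/
def phaseLength : ℕ → ℕ
  | 0 => 0
  | m + 1 => (m + 1) * phaseLength m + 1

lemma phaseLength_lt_succ (m : ℕ) : phaseLength m < phaseLength (m + 1) := by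
  simp only [phaseLength]
  nlinarith [Nat.zero_le (m * phaseLength m)]

lemma phaseLength_strictMono : StrictMono phaseLength :=
  strictMono_nat_of_lt_succ phaseLength_lt_succ

/-- Row lengths of the growing Young diagram with `k` boxes and `p + 2` rows. -/
def growthRow (p k j : ℕ) : ℕ :=
  let m := Nat.findGreatest (fun m => (p + 2) * phaseLength m ≤ k) k
  phaseRow p (phaseLength m) (phaseLength (m + 1) - phaseLength m)
    (k - (p + 2) * phaseLength m) j

lemma phaseRow_zero {p : ℕ} (hp : 0 < p) (a d j : ℕ) : phaseRow p a d 0 j = a := by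
  rcases j with _ | _ | l <;> simp [phaseRow]
  right; omega

lemma phaseRow_end {p : ℕ} (hp : 0 < p) (a d j : ℕ) :
    phaseRow p a d ((p + 2) * d) j = a + d := by
  have h : (p + 2) * d = p * d + 2 * d := by ring
  have h' : d ≤ p * d := Nat.le_mul_of_pos_left d hp
  rcases j with _ | _ | l
  · simp only [phaseRow]; omega
  · simp only [phaseRow]; omega
  · simp only [phaseRow]
    rw [h, Nat.add_sub_cancel, Nat.mul_add_div hp, Nat.div_eq_of_lt (by omega), add_zero]

lemma exists_phase (p k : ℕ) :
    ∃ m, (p + 2) * phaseLength m ≤ k ∧ k < (p + 2) * phaseLength (m + 1) := by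
  have hex : ∃ m, k < (p + 2) * phaseLength m := by
    refine ⟨k + 1, ?_⟩
    have := phaseLength_strictMono.le_apply (x := k + 1)
    nlinarith [Nat.zero_le (p * phaseLength (k + 1))]
  classical
  obtain ⟨m, hm⟩ : ∃ m, Nat.find hex = m + 1 := by
    refine Nat.exists_eq_succ_of_ne_zero fun h => ?_
    have := Nat.find_spec hex
    rw [h] at this
    simp [phaseLength] at this
  refine ⟨m, ?_, hm ▸ Nat.find_spec hex⟩
  exact not_lt.1 (Nat.find_min hex (by omega))

lemma growthRow_eq_of_lt {p m k : ℕ} (h₁ : (p + 2) * phaseLength m ≤ k)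
    (h₂ : k < (p + 2) * phaseLength (m + 1)) (j : ℕ) :
    growthRow p k j = phaseRow p (phaseLength m) (phaseLength (m + 1) - phaseLength m)
      (k - (p + 2) * phaseLength m) j := by
  have hm : Nat.findGreatest (fun m => (p + 2) * phaseLength m ≤ k) k = m := by
    rw [Nat.findGreatest_eq_iff]
    refine ⟨?_, fun _ => h₁, fun i hi _ h => ?_⟩
    · have := phaseLength_strictMono.le_apply (x := m)
      nlinarith [Nat.zero_le (p * phaseLength m)]
    · have := phaseLength_strictMono.monotone (Nat.succ_le_of_lt hi)
      have := Nat.mul_le_mul_left (p + 2) this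
      exact absurd (this.trans h) (not_le.2 h₂)
  simp only [growthRow, hm]

lemma growthRow_eq {p m k : ℕ} (hp : 0 < p) (h₁ : (p + 2) * phaseLength m ≤ k)
    (h₂ : k ≤ (p + 2) * phaseLength (m + 1)) (j : ℕ) :
    growthRow p k j = phaseRow p (phaseLength m) (phaseLength (m + 1) - phaseLength m)
      (k - (p + 2) * phaseLength m) j := by
  rcases h₂.lt_or_eq with h | rfl
  · exact growthRow_eq_of_lt h₁ h j
  · have := phaseLength_lt_succ m
    have := phaseLength_lt_succ (m + 1)
    rw [growthRow_eq_of_lt le_rfl (Nat.mul_lt_mul_of_pos_left this (by omega)), Nat.sub_self,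
      ← Nat.mul_sub, phaseRow_zero hp, phaseRow_end hp]
    omega

lemma phaseRow_le_succ (p a d s j : ℕ) : phaseRow p a d s j ≤ phaseRow p a d (s + 1) j := by
  rcases j with _ | _ | l
  · simp only [phaseRow]; omega
  · simp only [phaseRow]; omega
  · simp only [phaseRow]
    gcongr
    omega

lemma phaseRow_succ_le {p : ℕ} (hp : 0 < p) (a d s j : ℕ) :
    phaseRow p a d (s + 1) j ≤ phaseRow p a d s j + 1 := by
  rcases j with _ | _ | l
  · simp only [phaseRow]; omega
  · simp only [phaseRow]; omega
  · simp only [phaseRow]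
    rw [add_assoc, ← Nat.add_div_right _ hp]
    exact Nat.add_le_add_left (Nat.div_le_div_right (by omega)) a

lemma phaseRow_antitone {p : ℕ} (hp : 0 < p) {a d s : ℕ} (hs : s ≤ (p + 2) * d) :
    Antitone (phaseRow p a d s) := by
  refine antitone_nat_of_succ_le fun j => ?_
  rcases j with _ | _ | l
  · simp only [phaseRow]; omega
  · simp only [phaseRow]
    have h : (p + 2) * d = d * p + 2 * d := by ring
    gcongr
    rcases le_total s (2 * d) with h' | h'
    · rw [Nat.sub_eq_zero_of_le h', Nat.div_eq_of_lt (by omega)]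
      exact Nat.zero_le _
    · have : (s - 2 * d + (p - 1 - 0)) / p < d + 1 := by
        rw [Nat.div_lt_iff_lt_mul hp, add_mul d 1 p]
        omega
      omega
  · simp only [phaseRow]
    gcongr
    omega

lemma phaseRow_le_add_one {p : ℕ} (hp : 0 < p) {a d s : ℕ} (hs : s ≤ (p + 2) * d) (i : ℕ)
    {j : ℕ} (hj : 2 ≤ j) : phaseRow p a d s j ≤ phaseRow p a d s i + 1 := by
  rcases le_total i j with h | h
  · exact (phaseRow_antitone hp hs h).trans (Nat.le_succ _)
  · obtain ⟨j, rfl⟩ := Nat.exists_eq_add_of_le' hj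
    obtain ⟨i, rfl⟩ := Nat.exists_eq_add_of_le' (hj.trans h)
    simp only [phaseRow]
    rw [add_assoc, ← Nat.add_div_right _ hp]
    have : p - 1 - j ≤ p - 1 - i + p := by omega
    rw [add_assoc]
    gcongr

lemma sum_range_add_div {p : ℕ} (hp : 0 < p) (u : ℕ) :
    ∑ l ∈ Finset.range p, (u + l) / p = u := by
  induction u with
  | zero =>
    refine Finset.sum_eq_zero fun l hl => ?_
    rw [zero_add, Nat.div_eq_of_lt (Finset.mem_range.1 hl)]
  | succ u ih =>
    have h₁ := Finset.sum_range_succ (fun l => (u + l) / p) p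
    have h₂ := Finset.sum_range_succ' (fun l => (u + l) / p) p
    rw [Nat.add_div_right _ hp, ih] at h₁
    have h₃ : ∑ l ∈ Finset.range p, (u + 1 + l) / p = ∑ l ∈ Finset.range p, (u + (l + 1)) / p :=
      Finset.sum_congr rfl fun l _ => by rw [add_assoc, add_comm 1 l]
    rw [h₃]
    simp only [add_zero] at h₂
    omega

lemma sum_phaseRow {p : ℕ} (hp : 0 < p) (a d s : ℕ) :
    ∑ j ∈ Finset.range (p + 2), phaseRow p a d s j = (p + 2) * a + s := by
  rw [Finset.sum_range_succ', Finset.sum_range_succ']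
  have h := Finset.sum_range_reflect (fun l => (s - 2 * d + l) / p) p
  rw [sum_range_add_div hp] at h
  simp only [phaseRow, Finset.sum_add_distrib, Finset.sum_const, Finset.card_range, smul_eq_mul,
    h]
  rw [add_mul]
  omega

lemma phaseRow_switch {p : ℕ} (hp : 0 < p) {a d s i j : ℕ} (hi : i < p + 2) (hj : j < p + 2)
    (hi₁ : phaseRow p a d (s + 1) i = phaseRow p a d s i + 1)
    (hj₁ : phaseRow p a d (s + 1) j = phaseRow p a d s j)
    (hj₂ : phaseRow p a d (s + 2) j = phaseRow p a d (s + 1) j + 1) :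
    i < j ∨ phaseRow p a d (s + 1) i = phaseRow p a d (s + 1) j := by
  rcases i with _ | _ | i
  · rcases j with _ | j
    · omega
    · omega
  · rcases j with _ | _ | j
    · simp only [phaseRow] at *; omega
    · omega
    · omega
  · have hs : 2 * d ≤ s := by
      by_contra! h
      simp only [phaseRow] at hi₁
      rw [show s + 1 - 2 * d = s - 2 * d by omega] at hi₁
      omega
    rcases j with _ | _ | j
    · simp only [phaseRow] at *; omega
    · simp only [phaseRow] at *; omega
    · simp only [phaseRow] at *
      obtain ⟨u, rfl⟩ := Nat.exists_eq_add_of_le hs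
      simp only [show 2 * d + u + 1 - 2 * d = u + 1 by omega,
        show 2 * d + u + 2 - 2 * d = u + 2 by omega, Nat.add_sub_cancel_left] at *
      by_cases hij : i < j
      · left; omega
      right
      have h₁ : p ∣ u + (p - 1 - i) + 1 := by
        have := Nat.succ_div (a := u + (p - 1 - i)) (b := p)
        by_contra h
        rw [if_neg h] at this
        rw [add_right_comm] at hi₁
        omega
      have h₂ : p ∣ u + 1 + (p - 1 - j) + 1 := by
        have := Nat.succ_div (a := u + 1 + (p - 1 - j)) (b := p)
        by_contra h
        rw [if_neg h] at this
        rw [show u + 2 + (p - 1 - j) = u + 1 + (p - 1 - j) + 1 by omega] at hj₂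
        omega
      have h₃ : p ∣ i + 1 - j := by
        have := Nat.dvd_sub h₂ h₁
        rwa [show u + 1 + (p - 1 - j) + 1 - (u + (p - 1 - i) + 1) = i + 1 - j by omega] at this
      have h₄ := Nat.le_of_dvd (by omega) h₃
      obtain rfl : j = 0 := by omega
      obtain rfl : i = p - 1 := by omega
      rw [Nat.sub_self, add_zero] at h₁
      obtain ⟨v, hv⟩ := h₁
      rw [hv, Nat.mul_add_div hp, Nat.mul_add_div hp, Nat.div_eq_of_lt (by omega),
        Nat.div_eq_of_lt (by omega)]

lemma growthRow_rectangle {p : ℕ} (hp : 0 < p) (m j : ℕ) :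
    growthRow p ((p + 2) * phaseLength m) j = phaseLength m := by
  rw [growthRow_eq hp le_rfl (Nat.mul_le_mul_left _ (phaseLength_lt_succ m).le), Nat.sub_self,
    phaseRow_zero hp]

lemma growthRow_zero {p : ℕ} (hp : 0 < p) (j : ℕ) : growthRow p 0 j = 0 :=
  growthRow_rectangle hp 0 j

lemma growthRow_le_succ {p : ℕ} (hp : 0 < p) (k j : ℕ) :
    growthRow p k j ≤ growthRow p (k + 1) j := by
  obtain ⟨m, h₁, h₂⟩ := exists_phase p k
  rw [growthRow_eq hp h₁ h₂.le, growthRow_eq hp (h₁.trans k.le_succ) h₂, Nat.succ_sub h₁]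
  exact phaseRow_le_succ ..

lemma growthRow_succ_le {p : ℕ} (hp : 0 < p) (k j : ℕ) :
    growthRow p (k + 1) j ≤ growthRow p k j + 1 := by
  obtain ⟨m, h₁, h₂⟩ := exists_phase p k
  rw [growthRow_eq hp h₁ h₂.le, growthRow_eq hp (h₁.trans k.le_succ) h₂, Nat.succ_sub h₁]
  exact phaseRow_succ_le hp ..

lemma growthRow_antitone {p : ℕ} (hp : 0 < p) (k : ℕ) : Antitone (growthRow p k) := by
  obtain ⟨m, h₁, h₂⟩ := exists_phase p k
  intro i j hij
  rw [growthRow_eq hp h₁ h₂.le, growthRow_eq hp h₁ h₂.le]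
  refine phaseRow_antitone hp ?_ hij
  rw [Nat.mul_sub]
  omega

lemma growthRow_le_add_one {p : ℕ} (hp : 0 < p) (k i : ℕ) {j : ℕ} (hj : 2 ≤ j) :
    growthRow p k j ≤ growthRow p k i + 1 := by
  obtain ⟨m, h₁, h₂⟩ := exists_phase p k
  rw [growthRow_eq hp h₁ h₂.le, growthRow_eq hp h₁ h₂.le]
  refine phaseRow_le_add_one hp ?_ i hj
  rw [Nat.mul_sub]
  omega

lemma sum_growthRow {p : ℕ} (hp : 0 < p) (k : ℕ) :
    ∑ j ∈ Finset.range (p + 2), growthRow p k j = k := by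
  obtain ⟨m, h₁, h₂⟩ := exists_phase p k
  simp only [growthRow_eq hp h₁ h₂.le]
  rw [sum_phaseRow hp]
  omega

lemma growthRow_switch {p : ℕ} (hp : 0 < p) {k i j : ℕ} (hi : i < p + 2) (hj : j < p + 2)
    (hi₁ : growthRow p (k + 1) i = growthRow p k i + 1)
    (hj₁ : growthRow p (k + 1) j = growthRow p k j)
    (hj₂ : growthRow p (k + 2) j = growthRow p (k + 1) j + 1) :
    i < j ∨ growthRow p (k + 1) i = growthRow p (k + 1) j := by
  obtain ⟨m, h₁, h₂⟩ := exists_phase p k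
  rcases (Nat.succ_le_of_lt h₂).eq_or_lt with h | h
  · right
    rw [Nat.succ_eq_add_one] at h
    rw [h, growthRow_rectangle hp, growthRow_rectangle hp]
  · simp only [growthRow_eq hp h₁ h₂.le, growthRow_eq hp (h₁.trans k.le_succ) h₂,
      growthRow_eq hp (k := k + 2) (h₁.trans (by omega)) h, Nat.succ_eq_add_one, Nat.sub_add_comm h₁] at *
    exact phaseRow_switch hp hi hj hi₁ hj₁ hj₂

lemma growthRow_first {p : ℕ} (hp : 0 < p) (m j : ℕ) :
    growthRow p (phaseLength (m + 1) + (p + 1) * phaseLength m) j =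
      if j = 0 then phaseLength (m + 1) else phaseLength m := by
  have h := phaseLength_lt_succ m
  have h' := Nat.mul_le_mul_left (p + 1) h.le
  rw [growthRow_eq (m := m) hp (by rw [add_mul, add_mul] at *; omega)
    (by rw [add_mul, add_mul] at *; omega)]
  rw [show phaseLength (m + 1) + (p + 1) * phaseLength m - (p + 2) * phaseLength m =
    phaseLength (m + 1) - phaseLength m by rw [add_mul, add_mul] at *; omega]
  rcases j with _ | _ | l
  · simp only [phaseRow, if_true]; omega
  · simp [phaseRow]
  · simp only [phaseRow]
    rw [Nat.div_eq_of_lt (by omega)]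
    simp

lemma growthRow_second {p : ℕ} (hp : 0 < p) (m : ℕ) :
    growthRow p (2 * phaseLength (m + 1) + p * phaseLength m) 1 = phaseLength (m + 1) := by
  have h := phaseLength_lt_succ m
  have h' := Nat.mul_le_mul_left p h.le
  rw [growthRow_eq (m := m) hp (by rw [add_mul] at *; omega) (by rw [add_mul] at *; omega)]
  simp only [phaseRow]
  rw [add_mul]
  omega

/-- Piecewise linear interpolation of the row lengths. -/
noncomputable def growthPath (p : ℕ) (j : ℕ) (q : ℝ) : ℝ :=
  growthRow p ⌊q⌋₊ j + (q - ⌊q⌋₊) * (growthRow p (⌊q⌋₊ + 1) j - growthRow p ⌊q⌋₊ j)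

lemma growthPath_natCast (p j k : ℕ) : growthPath p j k = growthRow p k j := by
  simp [growthPath]

lemma growthPath_eq (p j k : ℕ) {q : ℝ} (hq : q ∈ Set.Icc (k : ℝ) (k + 1)) :
    growthPath p j q = growthRow p k j + (q - k) * (growthRow p (k + 1) j - growthRow p k j) := by
  rcases hq.2.lt_or_eq with h | rfl
  · have : ⌊q⌋₊ = k := (Nat.floor_eq_iff (k.cast_nonneg.trans hq.1)).2 ⟨hq.1, h⟩
    simp only [growthPath, this]
  · have := growthPath_natCast p j (k + 1)
    push_cast at this
    rw [this]
    ring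

lemma growthPath_convex (p : ℕ) {q : ℝ} (hq : 0 ≤ q) :
    ∃ k : ℕ, ∃ x : ℝ, 0 ≤ x ∧ 0 ≤ 1 - x ∧ q = k + x ∧
      ∀ j, growthPath p j q = (1 - x) * growthRow p k j + x * growthRow p (k + 1) j :=
  ⟨⌊q⌋₊, q - ⌊q⌋₊, sub_nonneg.2 (Nat.floor_le hq), by linarith [Nat.lt_floor_add_one q], by ring,
    fun j => by rw [growthPath]; ring⟩

lemma growthPath_nonneg (p j : ℕ) {q : ℝ} (hq : 0 ≤ q) : 0 ≤ growthPath p j q := by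
  obtain ⟨k, x, hx, hx', -, h⟩ := growthPath_convex p hq
  rw [h]
  positivity

lemma growthPath_antitone {p : ℕ} (hp : 0 < p) {q : ℝ} (hq : 0 ≤ q) {i j : ℕ} (hij : i ≤ j) :
    growthPath p j q ≤ growthPath p i q := by
  obtain ⟨k, x, hx, hx', -, h⟩ := growthPath_convex p hq
  rw [h, h]
  have h₁ := growthRow_antitone hp k hij
  have h₂ := growthRow_antitone hp (k + 1) hij
  gcongr

lemma growthPath_le_add_one {p : ℕ} (hp : 0 < p) {q : ℝ} (hq : 0 ≤ q) (i : ℕ) {j : ℕ}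
    (hj : 2 ≤ j) : growthPath p j q ≤ growthPath p i q + 1 := by
  obtain ⟨k, x, hx, hx', -, h⟩ := growthPath_convex p hq
  rw [h, h]
  have h₁ : (growthRow p k j : ℝ) ≤ growthRow p k i + 1 :=
    mod_cast growthRow_le_add_one hp k i hj
  have h₂ : (growthRow p (k + 1) j : ℝ) ≤ growthRow p (k + 1) i + 1 :=
    mod_cast growthRow_le_add_one hp (k + 1) i hj
  nlinarith

lemma sum_growthPath {p : ℕ} (hp : 0 < p) {q : ℝ} (hq : 0 ≤ q) :
    ∑ j ∈ Finset.range (p + 2), growthPath p j q = q := by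
  obtain ⟨k, x, hx, hx', hqx, h⟩ := growthPath_convex p hq
  simp only [h, Finset.sum_add_distrib, ← Finset.mul_sum, ← Nat.cast_sum, sum_growthRow hp]
  push_cast
  linarith

/-- The system attached to the interpolated row lengths. -/
noncomputable def growthSystem (p : ℕ) (j : Fin (p + 2)) (q : ℝ) : ℝ :=
  q - (p + 2) * growthPath p j q

lemma growthSystem_natCast (p : ℕ) (j : Fin (p + 2)) (k : ℕ) :
    growthSystem p j k = k - (p + 2) * growthRow p k j := by
  rw [growthSystem, growthPath_natCast]

lemma isNSystem_growthSystem {p : ℕ} (hp : 0 < p) : IsNSystem (p + 2) (growthSystem p) := by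
  have hp' : (0 : ℝ) < p + 2 := by positivity
  have hval : ∀ (k : ℕ) (j : Fin (p + 2)),
      growthRow p (k + 1) j = growthRow p k j ∨ growthRow p (k + 1) j = growthRow p k j + 1 :=
    fun k j => by
      have := growthRow_le_succ hp k j
      have := growthRow_succ_le hp k j
      omega
  let σ : ℕ → Fin (p + 2) → ℝ :=
    fun k j => 1 - (p + 2) * ((growthRow p (k + 1) j : ℝ) - growthRow p k j)
  have hneg : ∀ k j, σ k j = -(((p + 2 : ℕ) : ℝ) - 1) →
      growthRow p (k + 1) j = growthRow p k j + 1 := fun k j h => by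
    refine (hval k j).resolve_left fun h' => ?_
    simp only [σ, h'] at h
    push_cast at h
    linarith
  have hone : ∀ k j, σ k j = 1 → growthRow p (k + 1) j = growthRow p k j := fun k j h => by
    refine (hval k j).resolve_right fun h' => ?_
    simp only [σ, h'] at h
    push_cast at h
    linarith
  refine ⟨fun k => (k : ℝ), σ, Nat.cast_zero, Nat.strictMono_cast, tendsto_natCast_atTop_atTop,
    fun j => ?_, fun k j => ?_, fun k j q hq => ?_, fun q hq i j hij => ?_, fun q hq => ?_,
    fun k i j hi₁ _ hj₁ hj₂ => ?_⟩
  · simpa [growthRow_zero hp] using growthSystem_natCast p j 0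
  · rcases hval k j with h | h
    · right; simp [σ, h]
    · left; simp only [σ, h]; push_cast; ring
  · push_cast at hq
    rw [growthSystem_natCast, growthSystem, growthPath_eq p j k hq]
    simp only [σ]
    ring
  · have := growthPath_antitone hp hq (Fin.le_def.1 hij)
    simp only [growthSystem]
    gcongr
  · simp only [growthSystem, Finset.sum_sub_distrib, ← Finset.mul_sum]
    rw [Fin.sum_univ_eq_sum_range (fun j => growthPath p j q), sum_growthPath hp hq]
    simp
  · rcases growthRow_switch hp i.2 j.2 (hneg k i hi₁) (hone k j hj₁) (hneg (k + 1) j hj₂) with h | h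
    · exact Or.inl h
    · right
      rw [growthSystem_natCast, growthSystem_natCast, h]

lemma liminf_atTop_eq_of_tendsto {f : ℝ → ℝ} {c : ℝ} {x : ℕ → ℝ}
    (hle : ∀ ε > 0, ∀ᶠ q in atTop, c - ε ≤ f q) (hx : Tendsto x atTop atTop)
    (hfx : Tendsto (fun m => f (x m)) atTop (nhds c)) : liminf f atTop = c := by
  have hfreq : ∀ ε > 0, ∃ᶠ q in atTop, f q ≤ c + ε := fun ε hε =>
    hx.frequently (hfx.eventually (eventually_le_nhds (by linarith))).frequently
  refine le_antisymm (le_of_forall_pos_le_add fun ε hε => ?_)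
    (le_of_forall_pos_sub_le fun ε hε => ?_)
  · exact liminf_le_of_frequently_le (hfreq ε hε) ⟨c - 1, hle 1 one_pos⟩
  · exact le_liminf_of_le (IsCoboundedUnder.of_frequently_le (hfreq 1 one_pos)) (hle ε hε)

lemma limsup_atTop_eq_of_tendsto {f : ℝ → ℝ} {c : ℝ} {x : ℕ → ℝ}
    (hle : ∀ᶠ q in atTop, f q ≤ c) (hx : Tendsto x atTop atTop)
    (hfx : Tendsto (fun m => f (x m)) atTop (nhds c)) : limsup f atTop = c := by
  have hfreq : ∀ ε > 0, ∃ᶠ q in atTop, c - ε ≤ f q := fun ε hε =>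
    hx.frequently (hfx.eventually (eventually_ge_nhds (by linarith))).frequently
  refine le_antisymm ?_ (le_of_forall_pos_sub_le fun ε hε => ?_)
  · exact limsup_le_of_le (IsCoboundedUnder.of_frequently_ge (hfreq 1 one_pos)) hle
  · exact le_limsup_of_frequently_le (hfreq ε hε) ⟨c, hle⟩

lemma tendsto_phaseLength_ratio :
    Tendsto (fun m => (phaseLength m : ℝ) / phaseLength (m + 1)) atTop (nhds 0) := by
  refine squeeze_zero (fun m => by positivity) (fun m => ?_) tendsto_one_div_add_atTop_nhds_zero_nat
  have : (0 : ℝ) < phaseLength (m + 1) := mod_cast (Nat.zero_le _).trans_lt (phaseLength_lt_succ m)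
  rw [div_le_div_iff₀ this (by positivity)]
  simp only [phaseLength]
  push_cast
  linarith

lemma tendsto_mul_phaseLength_succ_add {b c : ℕ} (hb : 0 < b) :
    Tendsto (fun m => ((b * phaseLength (m + 1) + c * phaseLength m : ℕ) : ℝ)) atTop atTop := by
  refine tendsto_natCast_atTop_atTop.comp (tendsto_atTop_mono (fun m => ?_) tendsto_id)
  have h₁ := phaseLength_strictMono.le_apply (x := m + 1)
  have h₂ : phaseLength (m + 1) ≤ b * phaseLength (m + 1) := Nat.le_mul_of_pos_left _ hb
  simp only [id]
  omega

/-- Along phases, a quotient of linear forms in two consecutive rectangle lengths tends to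
the quotient of the leading coefficients. -/
lemma tendsto_growthSystem_div (p : ℕ) (j : Fin (p + 2)) {b c b' c' : ℕ} (hb : 0 < b)
    (h : ∀ m, growthRow p (b * phaseLength (m + 1) + c * phaseLength m) j =
      b' * phaseLength (m + 1) + c' * phaseLength m) :
    Tendsto (fun m => growthSystem p j ((b * phaseLength (m + 1) + c * phaseLength m : ℕ) : ℝ) /
      ((b * phaseLength (m + 1) + c * phaseLength m : ℕ) : ℝ)) atTop
      (nhds (1 - (p + 2) * b' / b)) := by
  have hb' : (b : ℝ) ≠ 0 := by positivity
  have key : Tendsto (fun m => 1 - ((p : ℝ) + 2) *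
      (b' + c' * ((phaseLength m : ℝ) / phaseLength (m + 1))) /
      (b + c * ((phaseLength m : ℝ) / phaseLength (m + 1)))) atTop
      (nhds (1 - (p + 2) * (b' + c' * 0) / (b + c * 0))) :=
    tendsto_const_nhds.sub <| (((tendsto_phaseLength_ratio.const_mul _).const_add _).const_mul
      _).div ((tendsto_phaseLength_ratio.const_mul _).const_add _) (by simpa using hb')
  simp only [mul_zero, add_zero] at key
  refine key.congr fun m => ?_
  have hA : (0 : ℝ) < phaseLength (m + 1) :=
    mod_cast (Nat.zero_le _).trans_lt (phaseLength_lt_succ m)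
  have hden : (0 : ℝ) < b * phaseLength (m + 1) + c * phaseLength m := by positivity
  rw [growthSystem_natCast, h]
  push_cast
  field_simp

lemma eventually_growthSystem_div_le {p : ℕ} {j : Fin (p + 2)} {c : ℝ}
    (h : ∀ q : ℝ, 0 ≤ q → growthSystem p j q ≤ c * q) :
    ∀ᶠ q in atTop, growthSystem p j q / q ≤ c := by
  filter_upwards [eventually_gt_atTop 0] with q hq
  rw [div_le_iff₀ hq]
  exact h q hq.le

lemma eventually_le_growthSystem_div {p : ℕ} {j : Fin (p + 2)} {c d : ℝ}
    (h : ∀ q : ℝ, 0 ≤ q → c * q - d ≤ growthSystem p j q) {ε : ℝ} (hε : 0 < ε) :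
    ∀ᶠ q in atTop, c - ε ≤ growthSystem p j q / q := by
  filter_upwards [eventually_gt_atTop 0, eventually_ge_atTop (d / ε)] with q hq hq'
  rw [le_div_iff₀ hq]
  rw [div_le_iff₀ hε] at hq'
  linarith [h q hq.le]

/-- For every integer `n ≥ 3` there exists an `n`-system `P = (P₁, …, Pₙ)`
(indexed here by `Fin n`, so `Pⱼ = P ⟨j-1, _⟩`) with
`liminf P₁(q)/q = -(n-1)`, `liminf P₂(q)/q = (2-n)/2`, `liminf Pⱼ(q)/q = 0` for `3 ≤ j ≤ n`,
`limsup P₁(q)/q = 0`, and `limsup Pⱼ(q)/q = 1` for `2 ≤ j ≤ n`. -/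
theorem exists_n_system_phibar_one_eq_zero (n : ℕ) (hn : 3 ≤ n) :
    ∃ P : Fin n → ℝ → ℝ, IsNSystem n P ∧
      liminf (fun q : ℝ => P ⟨0, by omega⟩ q / q) atTop = -((n : ℝ) - 1) ∧
      liminf (fun q : ℝ => P ⟨1, by omega⟩ q / q) atTop = (2 - (n : ℝ)) / 2 ∧
      (∀ j : Fin n, 2 ≤ (j : ℕ) → liminf (fun q : ℝ => P j q / q) atTop = 0) ∧
      limsup (fun q : ℝ => P ⟨0, by omega⟩ q / q) atTop = 0 ∧
      (∀ j : Fin n, 1 ≤ (j : ℕ) → limsup (fun q : ℝ => P j q / q) atTop = 1) := by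
  obtain ⟨p, rfl⟩ := Nat.exists_eq_add_of_le' (show 2 ≤ n by omega)
  have hp : 0 < p := by omega
  have hp' : (0 : ℝ) < p + 2 := by positivity
  have hrect : ∀ j : Fin (p + 2), ∀ m,
      growthRow p ((p + 2) * phaseLength (m + 1) + 0 * phaseLength m) j =
        1 * phaseLength (m + 1) + 0 * phaseLength m := fun j m => by
    simp only [zero_mul, add_zero, one_mul]
    exact growthRow_rectangle hp (m + 1) j
  have hrect' := fun j => tendsto_growthSystem_div p j (by omega) (hrect j)
  have hzero : 1 - ((p : ℝ) + 2) * ((1 : ℕ) : ℝ) / ((p + 2 : ℕ) : ℝ) = 0 := by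
    push_cast
    field_simp
    ring
  rw [hzero] at hrect'
  have hfirst : ∀ j : Fin (p + 2), 1 ≤ (j : ℕ) → ∀ m,
      growthRow p (1 * phaseLength (m + 1) + (p + 1) * phaseLength m) j =
        0 * phaseLength (m + 1) + 1 * phaseLength m := fun j hj m => by
    simp only [zero_mul, zero_add, one_mul]
    rw [growthRow_first hp, if_neg (by omega)]
  have hfirst₀ : ∀ m, growthRow p (1 * phaseLength (m + 1) + (p + 1) * phaseLength m)
      (⟨0, by omega⟩ : Fin (p + 2)) = 1 * phaseLength (m + 1) + 0 * phaseLength m := fun m => by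
    simp only [zero_mul, add_zero, one_mul]
    rw [growthRow_first hp, if_pos rfl]
  have hsecond : ∀ m, growthRow p (2 * phaseLength (m + 1) + p * phaseLength m)
      (⟨1, by omega⟩ : Fin (p + 2)) = 1 * phaseLength (m + 1) + 0 * phaseLength m := fun m => by
    simp only [zero_mul, add_zero, one_mul]
    exact growthRow_second hp m
  have hsum : ∀ q : ℝ, 0 ≤ q → growthPath p 0 q + growthPath p 1 q ≤ q := fun q hq => by
    have h := sum_growthPath hp hq
    rw [Finset.sum_range_succ', Finset.sum_range_succ'] at h
    have := Finset.sum_nonneg fun l (_ : l ∈ Finset.range p) => growthPath_nonneg p (l + 1 + 1) hq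
    simp only [zero_add] at h
    linarith
  refine ⟨growthSystem p, isNSystem_growthSystem hp, ?_, ?_, fun j hj => ?_, ?_, fun j hj => ?_⟩
  · refine liminf_atTop_eq_of_tendsto (fun ε hε => eventually_le_growthSystem_div (d := 0) ?_ hε)
      (tendsto_mul_phaseLength_succ_add (c := p + 1) one_pos) ?_
    · intro q hq
      have := growthPath_nonneg p 1 hq
      have := hsum q hq
      simp only [growthSystem]
      push_cast
      nlinarith
    · convert tendsto_growthSystem_div p _ one_pos hfirst₀ using 2
      push_cast
      ring
  · refine liminf_atTop_eq_of_tendsto (fun ε hε => eventually_le_growthSystem_div (d := 0) ?_ hε)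
      (tendsto_mul_phaseLength_succ_add (c := p) two_pos) ?_
    · intro q hq
      have := growthPath_antitone hp hq zero_le_one
      have := hsum q hq
      simp only [growthSystem]
      push_cast
      nlinarith
    · convert tendsto_growthSystem_div p _ two_pos hsecond using 2
      push_cast
      ring
  · refine liminf_atTop_eq_of_tendsto
      (fun ε hε => eventually_le_growthSystem_div (d := p + 2) ?_ hε)
      (tendsto_mul_phaseLength_succ_add (by omega)) (hrect' j)
    intro q hq
    have h := Finset.sum_le_sum fun i (_ : i ∈ Finset.range (p + 2)) =>
      growthPath_le_add_one hp hq i hj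
    rw [Finset.sum_add_distrib, sum_growthPath hp hq] at h
    simp only [Finset.sum_const, Finset.card_range, nsmul_eq_mul] at h
    push_cast at h
    simp only [growthSystem]
    linarith
  · refine limsup_atTop_eq_of_tendsto (eventually_growthSystem_div_le ?_)
      (tendsto_mul_phaseLength_succ_add (by omega)) (hrect' _)
    intro q hq
    have h := Finset.sum_le_sum fun i (_ : i ∈ Finset.range (p + 2)) =>
      growthPath_antitone hp hq (Nat.zero_le i)
    rw [sum_growthPath hp hq] at h
    simp only [Finset.sum_const, Finset.card_range, nsmul_eq_mul] at h
    push_cast at h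
    simp only [growthSystem]
    linarith
  · refine limsup_atTop_eq_of_tendsto (eventually_growthSystem_div_le ?_)
      (tendsto_mul_phaseLength_succ_add (c := p + 1) one_pos) ?_
    · intro q hq
      have := mul_nonneg hp'.le (growthPath_nonneg p j hq)
      simp only [growthSystem]
      linarith
    · convert tendsto_growthSystem_div p j one_pos (hfirst j hj) using 2
      simp
end
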